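/- Let W be a regular multiplicative unitary on a complex Hilbert space H, and Ŵ := ΣW*Σ. Assume that [(1 ⊗ b)·W·(a ⊗ 1) : a ∈ Â(W), b ∈ Â(Ŵ)] = Â(W) ⊗min Â(Ŵ). Then [(1 ⊗ k)·W·(k' ⊗ 1) : k, k' ∈ K(H)] = K(H ⊗ H), and consequently [(ω_{ξ,η} ⊗ id)(ΣW) : ξ, η ∈ H] = K(H), i.e. W is bi-regular. (In particular, a regular manageable multiplicative unitary is bi-regular.) -/

import Mathlib

/-!
Common framework: we axiomatize realizations of Hilbert-space tensor products.
A `TensorPair E F EF` realizes the Hilbert tensor product `E ⊗ F` as the Hilbert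
space `EF`: it consists of a bilinear map `(a, b) ↦ a ⊗ b` whose image satisfies
the characteristic inner-product identity and has total (dense) linear span.
Operators such as the leg operators `X₁₂`, `X₂₃`, `X₁₃`, amplifications `a ⊗ b`,
and the tensor flip `Σ` are then uniquely characterized by their matrix
coefficients against elementary tensors.
-/

noncomputable section

open scoped InnerProductSpace
open ContinuousLinearMap

/-- A realization of the Hilbert tensor product `E ⊗ F` as the Hilbert space `EF`. -/
structure TensorPair (E F EF : Type*)
    [NormedAddCommGroup E] [InnerProductSpace ℂ E]
    [NormedAddCommGroup F] [InnerProductSpace ℂ F]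
    [NormedAddCommGroup EF] [InnerProductSpace ℂ EF] where
  tmul : E →ₗ[ℂ] F →ₗ[ℂ] EF
  inner_tmul : ∀ (a c : E) (b d : F), ⟪tmul a b, tmul c d⟫_ℂ = ⟪a, c⟫_ℂ * ⟪b, d⟫_ℂ
  dense_span : Dense (Submodule.span ℂ {z : EF | ∃ a b, z = tmul a b} : Set EF)

/-- A realization of the threefold Hilbert tensor product `E ⊗ F ⊗ G` as `EFG`. -/
structure TensorTriple (E F G EFG : Type*)
    [NormedAddCommGroup E] [InnerProductSpace ℂ E]
    [NormedAddCommGroup F] [InnerProductSpace ℂ F]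
    [NormedAddCommGroup G] [InnerProductSpace ℂ G]
    [NormedAddCommGroup EFG] [InnerProductSpace ℂ EFG] where
  tmul : E →ₗ[ℂ] F →ₗ[ℂ] G →ₗ[ℂ] EFG
  inner_tmul : ∀ (a a' : E) (b b' : F) (c c' : G),
    ⟪tmul a b c, tmul a' b' c'⟫_ℂ = ⟪a, a'⟫_ℂ * ⟪b, b'⟫_ℂ * ⟪c, c'⟫_ℂ
  dense_span : Dense (Submodule.span ℂ {z : EFG | ∃ a b c, z = tmul a b c} : Set EFG)

/-- The norm-closed linear span `[S]` of a set of vectors/operators. -/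
def cspan {V : Type*} [NormedAddCommGroup V] [NormedSpace ℂ V] (S : Set V) : Set V :=
  closure (Submodule.span ℂ S : Set V)

/-- The set of right-leg slices `(id ⊗ ω_{ξ,η})(X)` of an operator
`X : M₁ ⊗ K₁ → M₂ ⊗ K₂`, i.e. all operators `T : M₁ → M₂` such that
`⟪ζ, T ζ'⟫ = ⟪ζ ⊗ ξ, X (ζ' ⊗ η)⟫` for some `ξ ∈ K₂`, `η ∈ K₁`. -/
def slicesR {M₁ K₁ M₂ K₂ Ha Hb : Type*}
    [NormedAddCommGroup M₁] [InnerProductSpace ℂ M₁]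
    [NormedAddCommGroup K₁] [InnerProductSpace ℂ K₁]
    [NormedAddCommGroup M₂] [InnerProductSpace ℂ M₂]
    [NormedAddCommGroup K₂] [InnerProductSpace ℂ K₂]
    [NormedAddCommGroup Ha] [InnerProductSpace ℂ Ha]
    [NormedAddCommGroup Hb] [InnerProductSpace ℂ Hb]
    (ta : TensorPair M₁ K₁ Ha) (tb : TensorPair M₂ K₂ Hb)
    (X : Ha →L[ℂ] Hb) : Set (M₁ →L[ℂ] M₂) :=
  {T | ∃ (ξ : K₂) (η : K₁), ∀ (ζ : M₂) (ζ' : M₁),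
    ⟪ζ, T ζ'⟫_ℂ = ⟪tb.tmul ζ ξ, X (ta.tmul ζ' η)⟫_ℂ}

/-- The set of left-leg slices `(ω_{ξ,η} ⊗ id)(X)` of an operator
`X : K₁ ⊗ M₁ → K₂ ⊗ M₂`, i.e. all operators `T : M₁ → M₂` such that
`⟪ζ, T ζ'⟫ = ⟪ξ ⊗ ζ, X (η ⊗ ζ')⟫` for some `ξ ∈ K₂`, `η ∈ K₁`. -/
def slicesL {M₁ K₁ M₂ K₂ Ha Hb : Type*}
    [NormedAddCommGroup M₁] [InnerProductSpace ℂ M₁]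
    [NormedAddCommGroup K₁] [InnerProductSpace ℂ K₁]
    [NormedAddCommGroup M₂] [InnerProductSpace ℂ M₂]
    [NormedAddCommGroup K₂] [InnerProductSpace ℂ K₂]
    [NormedAddCommGroup Ha] [InnerProductSpace ℂ Ha]
    [NormedAddCommGroup Hb] [InnerProductSpace ℂ Hb]
    (ta : TensorPair K₁ M₁ Ha) (tb : TensorPair K₂ M₂ Hb)
    (X : Ha →L[ℂ] Hb) : Set (M₁ →L[ℂ] M₂) :=
  {T | ∃ (ξ : K₂) (η : K₁), ∀ (ζ : M₂) (ζ' : M₁),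
    ⟪ζ, T ζ'⟫_ℂ = ⟪tb.tmul ξ ζ, X (ta.tmul η ζ')⟫_ℂ}

/-- `Â(X) := [(id ⊗ ω_{ξ,η})(X) : ξ, η ∈ H] ⊆ B(H)` for `X ∈ B(H ⊗ H)`. -/
def hatA {H H2 : Type*}
    [NormedAddCommGroup H] [InnerProductSpace ℂ H]
    [NormedAddCommGroup H2] [InnerProductSpace ℂ H2]
    (t2 : TensorPair H H H2) (X : H2 →L[ℂ] H2) : Set (H →L[ℂ] H) :=
  cspan (slicesR t2 t2 X)

/-- `A(X) := [(ω_{ξ,η} ⊗ id)(X) : ξ, η ∈ H] ⊆ B(H)` for `X ∈ B(H ⊗ H)`. -/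
def legA {H H2 : Type*}
    [NormedAddCommGroup H] [InnerProductSpace ℂ H]
    [NormedAddCommGroup H2] [InnerProductSpace ℂ H2]
    (t2 : TensorPair H H H2) (X : H2 →L[ℂ] H2) : Set (H →L[ℂ] H) :=
  cspan (slicesL t2 t2 X)

/-- `T` is the tensor-product operator `a ⊗ b : E ⊗ F → E' ⊗ F'`, characterized by its
matrix coefficients against elementary tensors.  In particular `IsTensorOp ta tb a 1 T`
says that `T = a ⊗ 1`, and `IsTensorOp ta tb 1 b T` that `T = 1 ⊗ b`. -/
def IsTensorOp {E F EF E' F' EF' : Type*}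
    [NormedAddCommGroup E] [InnerProductSpace ℂ E]
    [NormedAddCommGroup F] [InnerProductSpace ℂ F]
    [NormedAddCommGroup EF] [InnerProductSpace ℂ EF]
    [NormedAddCommGroup E'] [InnerProductSpace ℂ E']
    [NormedAddCommGroup F'] [InnerProductSpace ℂ F']
    [NormedAddCommGroup EF'] [InnerProductSpace ℂ EF']
    (ta : TensorPair E F EF) (tb : TensorPair E' F' EF')
    (a : E →L[ℂ] E') (b : F →L[ℂ] F') (T : EF →L[ℂ] EF') : Prop :=
  ∀ (ζ : E') (ξ : F') (ζ' : E) (η : F),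
    ⟪tb.tmul ζ ξ, T (ta.tmul ζ' η)⟫_ℂ = ⟪ζ, a ζ'⟫_ℂ * ⟪ξ, b η⟫_ℂ

/-- `A ⊗min B := [(a ⊗ 1)(1 ⊗ b) : a ∈ A, b ∈ B] = [a ⊗ b : a ∈ A, b ∈ B]`. -/
def minTensor {E F EF : Type*}
    [NormedAddCommGroup E] [InnerProductSpace ℂ E]
    [NormedAddCommGroup F] [InnerProductSpace ℂ F]
    [NormedAddCommGroup EF] [InnerProductSpace ℂ EF]
    (t : TensorPair E F EF)
    (A : Set (E →L[ℂ] E)) (B : Set (F →L[ℂ] F)) : Set (EF →L[ℂ] EF) :=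
  cspan {T | ∃ a ∈ A, ∃ b ∈ B, IsTensorOp t t a b T}

/-- `Y = X₁₂ = X ⊗ 1` on `E ⊗ F ⊗ G`, for `X ∈ B(E ⊗ F)`. -/
def IsLeg12 {E F G EF EFG : Type*}
    [NormedAddCommGroup E] [InnerProductSpace ℂ E]
    [NormedAddCommGroup F] [InnerProductSpace ℂ F]
    [NormedAddCommGroup G] [InnerProductSpace ℂ G]
    [NormedAddCommGroup EF] [InnerProductSpace ℂ EF]
    [NormedAddCommGroup EFG] [InnerProductSpace ℂ EFG]
    (t2 : TensorPair E F EF) (t3 : TensorTriple E F G EFG)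
    (X : EF →L[ℂ] EF) (Y : EFG →L[ℂ] EFG) : Prop :=
  ∀ (a a' : E) (b b' : F) (c c' : G),
    ⟪t3.tmul a b c, Y (t3.tmul a' b' c')⟫_ℂ
      = ⟪t2.tmul a b, X (t2.tmul a' b')⟫_ℂ * ⟪c, c'⟫_ℂ

/-- `Y = X₂₃ = 1 ⊗ X` on `E ⊗ F ⊗ G`, for `X ∈ B(F ⊗ G)`. -/
def IsLeg23 {E F G FG EFG : Type*}
    [NormedAddCommGroup E] [InnerProductSpace ℂ E]
    [NormedAddCommGroup F] [InnerProductSpace ℂ F]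
    [NormedAddCommGroup G] [InnerProductSpace ℂ G]
    [NormedAddCommGroup FG] [InnerProductSpace ℂ FG]
    [NormedAddCommGroup EFG] [InnerProductSpace ℂ EFG]
    (t2 : TensorPair F G FG) (t3 : TensorTriple E F G EFG)
    (X : FG →L[ℂ] FG) (Y : EFG →L[ℂ] EFG) : Prop :=
  ∀ (a a' : E) (b b' : F) (c c' : G),
    ⟪t3.tmul a b c, Y (t3.tmul a' b' c')⟫_ℂ
      = ⟪t2.tmul b c, X (t2.tmul b' c')⟫_ℂ * ⟪a, a'⟫_ℂ

/-- `Y = X₁₃ = Σ₁₂X₂₃Σ₁₂` on `E ⊗ F ⊗ G`, for `X ∈ B(E ⊗ G)`: `X` acting on the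
first and third legs. -/
def IsLeg13 {E F G EG EFG : Type*}
    [NormedAddCommGroup E] [InnerProductSpace ℂ E]
    [NormedAddCommGroup F] [InnerProductSpace ℂ F]
    [NormedAddCommGroup G] [InnerProductSpace ℂ G]
    [NormedAddCommGroup EG] [InnerProductSpace ℂ EG]
    [NormedAddCommGroup EFG] [InnerProductSpace ℂ EFG]
    (t2 : TensorPair E G EG) (t3 : TensorTriple E F G EFG)
    (X : EG →L[ℂ] EG) (Y : EFG →L[ℂ] EFG) : Prop :=
  ∀ (a a' : E) (b b' : F) (c c' : G),
    ⟪t3.tmul a b c, Y (t3.tmul a' b' c')⟫_ℂ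
      = ⟪t2.tmul a c, X (t2.tmul a' c')⟫_ℂ * ⟪b, b'⟫_ℂ

/-! ### Helper lemmas -/

theorem cspan_subset_of_closed {V : Type*} [NormedAddCommGroup V] [NormedSpace ℂ V]
    {S : Set V} (M : Submodule ℂ V) (hM : IsClosed (M : Set V)) (h : S ⊆ M) :
    cspan S ⊆ M :=
  closure_minimal (Submodule.span_le.2 h) hM

theorem cspan_coe {V : Type*} [NormedAddCommGroup V] [NormedSpace ℂ V] (S : Set V) :
    cspan S = ((Submodule.span ℂ S).topologicalClosure : Set V) := rfl

theorem subset_cspan {V : Type*} [NormedAddCommGroup V] [NormedSpace ℂ V] (S : Set V) :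
    S ⊆ cspan S := Submodule.subset_span.trans subset_closure

theorem cspan_map {V V' : Type*} [NormedAddCommGroup V] [NormedSpace ℂ V]
    [NormedAddCommGroup V'] [NormedSpace ℂ V'] {σ : ℂ →+* ℂ} [RingHomSurjective σ]
    (φ : V →SL[σ] V') {S : Set V}
    (M : Submodule ℂ V') (hM : IsClosed (M : Set V')) (h : ∀ s ∈ S, φ s ∈ M) :
    ∀ t ∈ cspan S, φ t ∈ M := by
  have := cspan_subset_of_closed (S := S) (M.comap (φ : V →ₛₗ[σ] V'))
    (hM.preimage φ.continuous) (fun s hs => h s hs)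
  exact fun t ht => this ht

/-- compact operators as a submodule -/
def cpt (E : Type*) [NormedAddCommGroup E] [InnerProductSpace ℂ E] : Submodule ℂ (E →L[ℂ] E) :=
  compactOperator (RingHom.id ℂ) E E

theorem mem_cpt {E : Type*} [NormedAddCommGroup E] [InnerProductSpace ℂ E] (T : E →L[ℂ] E) :
    T ∈ cpt E ↔ IsCompactOperator T := Iff.rfl

theorem isClosed_cpt (E : Type*) [NormedAddCommGroup E] [InnerProductSpace ℂ E]
    [CompleteSpace E] : IsClosed (cpt E : Set (E →L[ℂ] E)) :=
  isClosed_setOfPred_isCompactOperator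

theorem rankOne_cpt {E : Type*} [NormedAddCommGroup E] [InnerProductSpace ℂ E] (x y : E) :
    InnerProductSpace.rankOne ℂ x y ∈ cpt E := by
  rw [mem_cpt]
  have h : IsCompactOperator (innerSL ℂ y) := isCompactOperator_of_locallyCompactSpace_dom _
  have := h.clm_comp (toSpanSingleton ℂ x)
  have e : (⇑(InnerProductSpace.rankOne ℂ x y) : E → E) = ⇑(toSpanSingleton ℂ x) ∘ ⇑(innerSL ℂ y) := by
    ext z; simp
  rw [e]
  exact this

theorem cpt_subset {E : Type*} [NormedAddCommGroup E] [InnerProductSpace ℂ E]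
    [CompleteSpace E] (M : Submodule ℂ (E →L[ℂ] E)) (hM : IsClosed (M : Set (E →L[ℂ] E)))
    (h : ∀ x y, InnerProductSpace.rankOne ℂ x y ∈ M) (T : E →L[ℂ] E) (hT : T ∈ cpt E) : T ∈ M := by
  rw [mem_cpt] at hT
  have hc := hT.isCompact_closure_image_closedBall (f := (T : E →ₗ[ℂ] E)) 1
  have htb : TotallyBounded (T '' Metric.closedBall 0 1) :=
    hc.totallyBounded.subset subset_closure
  have : T ∈ closure (M : Set (E →L[ℂ] E)) := by
    rw [Metric.mem_closure_iff]
    intro ε hε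
    obtain ⟨t, htf, ht⟩ := Metric.totallyBounded_iff.1 htb (ε / 2) (by positivity)
    let V := Submodule.span ℂ t
    have : FiniteDimensional ℂ V := FiniteDimensional.span_of_finite ℂ htf
    let P : E →L[ℂ] E := V.starProjection
    refine ⟨P * T, ?_, ?_⟩
    · let b := stdOrthonormalBasis ℂ V
      have : P * T = ∑ i, InnerProductSpace.rankOne ℂ (b i : E) (adjoint T (b i : E)) := by
        ext x
        have h1 := b.sum_repr' (V.orthogonalProjectionOnto (T x))
        have h2 := congrArg (Subtype.val) h1
        simp only [mul_apply, sum_apply, InnerProductSpace.rankOne_apply, adjoint_inner_left]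
        change ((V.orthogonalProjectionOnto (T x) : V) : E) = _
        rw [← h2]
        simp [Submodule.coe_inner]
      rw [this]
      exact M.sum_mem fun i _ => h _ _
    · rw [dist_eq_norm]
      refine lt_of_le_of_lt (opNorm_le_of_unit_norm (𝕜 := ℂ) (C := ε / 2) (by positivity) ?_) (by linarith)
      intro x hx
      have hx' : T x ∈ T '' Metric.closedBall 0 1 := ⟨x, by simp [hx], rfl⟩
      obtain ⟨y, hy, hxy⟩ := Set.mem_iUnion₂.1 (ht hx')
      have hyV : y ∈ V := Submodule.subset_span hy
      change ‖T x - V.starProjection (T x)‖ ≤ ε / 2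
      rw [Submodule.starProjection_minimal]
      refine (ciInf_le ⟨0, ?_⟩ (⟨y, hyV⟩ : V)).trans ?_
      · rintro _ ⟨z, rfl⟩; positivity
      · rw [Metric.mem_ball, dist_eq_norm] at hxy
        exact hxy.le
  rwa [hM.closure_eq] at this

set_option linter.unusedSectionVars false
section T
variable {H H2 : Type*}
    [NormedAddCommGroup H] [InnerProductSpace ℂ H] [CompleteSpace H]
    [NormedAddCommGroup H2] [InnerProductSpace ℂ H2] [CompleteSpace H2]
    (t2 : TensorPair H H H2)

theorem norm_tm (x y : H) : ‖t2.tmul x y‖ = ‖x‖ * ‖y‖ := by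
  have h := t2.inner_tmul x x y y
  simp only [inner_self_eq_norm_sq_to_K] at h
  have h' : ‖t2.tmul x y‖ ^ 2 = (‖x‖ * ‖y‖) ^ 2 := by
    rw [mul_pow]; exact_mod_cast h
  exact (sq_eq_sq₀ (by positivity) (by positivity)).1 h'

theorem tm_ext {z w : H2} (h : ∀ x y, ⟪t2.tmul x y, z⟫_ℂ = ⟪t2.tmul x y, w⟫_ℂ) : z = w := by
  refine t2.dense_span.eq_of_inner_right (𝕜 := ℂ) ?_
  intro v hv
  induction hv using Submodule.span_induction with
  | mem x hx => obtain ⟨a, b, rfl⟩ := hx; exact h a b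
  | zero => simp
  | add x y _ _ hx hy => simp [inner_add_left, hx, hy]
  | smul c x _ hx => simp [inner_smul_left, hx]

theorem op_ext {S T : H2 →L[ℂ] H2} (h : ∀ x y, S (t2.tmul x y) = T (t2.tmul x y)) : S = T := by
  refine ContinuousLinearMap.ext_on t2.dense_span ?_
  rintro _ ⟨a, b, rfl⟩
  exact h a b

def Lt (e : H) : H →L[ℂ] H2 :=
  (t2.tmul.flip e).mkContinuous ‖e‖ fun x => by
    rw [LinearMap.flip_apply, norm_tm, mul_comm]

def Rt (e : H) : H →L[ℂ] H2 :=
  (t2.tmul e).mkContinuous ‖e‖ fun x => by rw [norm_tm]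

theorem Lt_apply (e x : H) : Lt t2 e x = t2.tmul x e := rfl
theorem Rt_apply (e x : H) : Rt t2 e x = t2.tmul e x := rfl

open scoped TensorProduct in
def emb : H ⊗[ℂ] H →ₗ[ℂ] H2 := TensorProduct.lift t2.tmul

open scoped TensorProduct in
theorem emb_inner (z w : H ⊗[ℂ] H) : ⟪emb t2 z, emb t2 w⟫_ℂ = ⟪z, w⟫_ℂ := by
  induction z using TensorProduct.induction_on with
  | zero => simp
  | add x y hx hy => simp [inner_add_left, hx, hy]
  | tmul a b =>
    induction w using TensorProduct.induction_on with
    | zero => simp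
    | add x y hx hy => simp [inner_add_right, hx, hy]
    | tmul c d => simp [emb, t2.inner_tmul]

open scoped TensorProduct in
theorem emb_norm (z : H ⊗[ℂ] H) : ‖emb t2 z‖ = ‖z‖ := by
  rw [norm_eq_sqrt_re_inner (𝕜 := ℂ), emb_inner]
  exact (norm_eq_sqrt_re_inner (𝕜 := ℂ) z).symm

theorem emb_dense : DenseRange (emb t2) := by
  refine t2.dense_span.mono ?_
  change _ ≤ LinearMap.range (emb t2)
  rw [Submodule.span_le]
  rintro _ ⟨a, b, rfl⟩
  exact ⟨a ⊗ₜ[ℂ] b, by simp [emb]⟩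

def tens (a b : H →L[ℂ] H) : H2 →L[ℂ] H2 :=
  (emb t2 ∘ₗ (TensorProduct.map (a : H →ₗ[ℂ] H) (b : H →ₗ[ℂ] H))).extendOfNorm (emb t2)

theorem tens_bound (a b : H →L[ℂ] H) (x) :
    ‖(emb t2 ∘ₗ (TensorProduct.map (a : H →ₗ[ℂ] H) (b : H →ₗ[ℂ] H))) x‖
      ≤ (‖a‖ * ‖b‖) * ‖emb t2 x‖ := by
  rw [LinearMap.comp_apply, emb_norm, emb_norm]
  have := (TensorProduct.mapL a b).le_of_opNorm_le (TensorProduct.norm_mapL_le a b) x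
  rwa [TensorProduct.mapL_apply] at this

theorem tens_tmul (a b : H →L[ℂ] H) (x y : H) :
    tens t2 a b (t2.tmul x y) = t2.tmul (a x) (b y) := by
  have := LinearMap.extendOfNorm_eq (emb_dense t2) ⟨_, tens_bound t2 a b⟩ (x ⊗ₜ[ℂ] y)
  simpa [emb, tens] using this

theorem norm_tens (a b : H →L[ℂ] H) : ‖tens t2 a b‖ ≤ ‖a‖ * ‖b‖ :=
  LinearMap.opNorm_extendOfNorm_le (emb_dense t2) (by positivity) (tens_bound t2 a b)

def f1 : (H →L[ℂ] H) →L[ℂ] (H2 →L[ℂ] H2) :=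
  LinearMap.mkContinuous
    { toFun := fun a => tens t2 a 1
      map_add' := fun a b => op_ext t2 fun x y => by simp [tens_tmul]
      map_smul' := fun c a => op_ext t2 fun x y => by simp [tens_tmul] } ‖(1 : H →L[ℂ] H)‖
    fun a => by rw [mul_comm]; exact norm_tens t2 a 1

def f2 : (H →L[ℂ] H) →L[ℂ] (H2 →L[ℂ] H2) :=
  LinearMap.mkContinuous
    { toFun := fun a => tens t2 1 a
      map_add' := fun a b => op_ext t2 fun x y => by simp [tens_tmul]
      map_smul' := fun c a => op_ext t2 fun x y => by simp [tens_tmul] } ‖(1 : H →L[ℂ] H)‖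
    fun a => norm_tens t2 1 a

theorem f1_tmul (a : H →L[ℂ] H) (x y : H) : f1 t2 a (t2.tmul x y) = t2.tmul (a x) y :=
  tens_tmul t2 a 1 x y
theorem f2_tmul (a : H →L[ℂ] H) (x y : H) : f2 t2 a (t2.tmul x y) = t2.tmul x (a y) :=
  tens_tmul t2 1 a x y

theorem f1_mul (a b : H →L[ℂ] H) : f1 t2 (a * b) = f1 t2 a * f1 t2 b :=
  op_ext t2 fun x y => by simp [f1_tmul]
theorem f2_mul (a b : H →L[ℂ] H) : f2 t2 (a * b) = f2 t2 a * f2 t2 b :=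
  op_ext t2 fun x y => by simp [f2_tmul]
theorem f_comm (a b : H →L[ℂ] H) : f2 t2 b * f1 t2 a = f1 t2 a * f2 t2 b :=
  op_ext t2 fun x y => by simp [f1_tmul, f2_tmul]

theorem isTensorOp_iff (a b : H →L[ℂ] H) (T : H2 →L[ℂ] H2) :
    IsTensorOp t2 t2 a b T ↔ T = f1 t2 a * f2 t2 b := by
  constructor
  · intro h
    refine op_ext t2 fun x y => tm_ext t2 fun u v => ?_
    rw [h u v x y]
    simp [f1_tmul, f2_tmul, t2.inner_tmul]
  · rintro rfl u v x y
    simp [f1_tmul, f2_tmul, t2.inner_tmul]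

theorem f1_one : f1 t2 1 = 1 := op_ext t2 fun x y => by simp [f1_tmul]
theorem f2_one : f2 t2 1 = 1 := op_ext t2 fun x y => by simp [f2_tmul]

theorem isTensorOp_left (a : H →L[ℂ] H) (T : H2 →L[ℂ] H2) :
    IsTensorOp t2 t2 a 1 T ↔ T = f1 t2 a := by rw [isTensorOp_iff, f2_one, mul_one]
theorem isTensorOp_right (a : H →L[ℂ] H) (T : H2 →L[ℂ] H2) :
    IsTensorOp t2 t2 1 a T ↔ T = f2 t2 a := by rw [isTensorOp_iff, f1_one, one_mul]

theorem f_rankOne (x y u v : H) :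
    f1 t2 (InnerProductSpace.rankOne ℂ x y) * f2 t2 (InnerProductSpace.rankOne ℂ u v)
      = InnerProductSpace.rankOne ℂ (t2.tmul x u) (t2.tmul y v) := by
  refine op_ext t2 fun p q => ?_
  simp [f1_tmul, f2_tmul, t2.inner_tmul, smul_smul, mul_comm]

theorem f_cpt (k k' : H →L[ℂ] H) (hk : k ∈ cpt H) (hk' : k' ∈ cpt H) :
    f1 t2 k * f2 t2 k' ∈ cpt H2 := by
  let φ : (H →L[ℂ] H) →L[ℂ] (H2 →L[ℂ] H2) := (ContinuousLinearMap.mul ℂ _).flip (f2 t2 k') ∘L f1 t2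
  refine cpt_subset ((cpt H2).comap (φ : (H →L[ℂ] H) →ₗ[ℂ] (H2 →L[ℂ] H2)))
    ((isClosed_cpt H2).preimage φ.continuous) (fun x y => ?_) k hk
  let ψ : (H →L[ℂ] H) →L[ℂ] (H2 →L[ℂ] H2) :=
    (ContinuousLinearMap.mul ℂ _) (f1 t2 (InnerProductSpace.rankOne ℂ x y)) ∘L f2 t2
  refine cpt_subset ((cpt H2).comap (ψ : (H →L[ℂ] H) →ₗ[ℂ] (H2 →L[ℂ] H2)))
    ((isClosed_cpt H2).preimage ψ.continuous) (fun u v => ?_) k' hk'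
  change f1 t2 _ * f2 t2 _ ∈ cpt H2
  rw [f_rankOne]
  exact rankOne_cpt _ _

theorem cspan_tm (z : H2) : z ∈ cspan {z : H2 | ∃ a b, z = t2.tmul a b} := t2.dense_span z

theorem cpt2_subset (M : Submodule ℂ (H2 →L[ℂ] H2)) (hM : IsClosed (M : Set (H2 →L[ℂ] H2)))
    (h : ∀ k ∈ cpt H, ∀ k' ∈ cpt H, f1 t2 k * f2 t2 k' ∈ M) (T : H2 →L[ℂ] H2) (hT : T ∈ cpt H2) :
    T ∈ M := by
  refine cpt_subset M hM (fun p q => ?_) T hT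
  refine cspan_map (InnerProductSpace.rankOne ℂ p) M hM ?_ q (cspan_tm t2 q)
  rintro _ ⟨y, v, rfl⟩
  refine cspan_map ((InnerProductSpace.rankOne ℂ (E := H2) (F := H2)).flip (t2.tmul y v)) M hM ?_ p
    (cspan_tm t2 p)
  rintro _ ⟨x, u, rfl⟩
  rw [ContinuousLinearMap.flip_apply, ← f_rankOne]
  exact h _ (rankOne_cpt _ _) _ (rankOne_cpt _ _)

theorem slice_mem (X : H2 →L[ℂ] H2) (ξ η : H) :
    adjoint (Lt t2 ξ) ∘L X ∘L Lt t2 η ∈ slicesR t2 t2 X :=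
  ⟨ξ, η, fun ζ ζ' => by simp [adjoint_inner_right, Lt_apply]⟩

theorem dense_of_orth {S : Set H} (h : ∀ z, (∀ s ∈ S, ⟪s, z⟫_ℂ = 0) → z = 0) (x : H) :
    x ∈ cspan S := by
  have : (Submodule.span ℂ S).topologicalClosure = ⊤ := by
    rw [Submodule.topologicalClosure_eq_top_iff, Submodule.eq_bot_iff]
    intro z hz
    exact h z fun s hs => (Submodule.mem_orthogonal _ z).1 hz s (Submodule.subset_span hs)
  change x ∈ (Submodule.span ℂ S).topologicalClosure
  rw [this]; trivial

/-- `K ⊆ [Â(X) K]` -/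
theorem nondeg_left (X : H2 →L[ℂ] H2) (hX : X * star X = 1)
    (M : Submodule ℂ (H →L[ℂ] H)) (hM : IsClosed (M : Set (H →L[ℂ] H)))
    (h : ∀ a ∈ hatA t2 X, ∀ k ∈ cpt H, a * k ∈ M) (T : H →L[ℂ] H) (hT : T ∈ cpt H) : T ∈ M := by
  refine cpt_subset M hM (fun x y => ?_) T hT
  refine cspan_map ((InnerProductSpace.rankOne ℂ (E := H) (F := H)).flip y) M hM ?_ x
    (dense_of_orth (S := {z | ∃ a ∈ slicesR t2 t2 X, ∃ w, z = a w}) ?_ x)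
  · rintro _ ⟨a, ha, w, rfl⟩
    have := h a (subset_cspan _ ha) _ (rankOne_cpt w y)
    convert this using 1
    ext p; simp
  · intro z hz
    have h0 : star X (t2.tmul z z) = 0 := by
      refine tm_ext t2 fun x' η => ?_
      have := hz _ ⟨_, slice_mem t2 X z η, x', rfl⟩
      simpa [star_eq_adjoint, adjoint_inner_left, adjoint_inner_right, Lt_apply] using this
    have h1 : t2.tmul z z = 0 := by
      have := congrArg (fun S : H2 →L[ℂ] H2 => S (t2.tmul z z)) hX
      simpa [h0] using this.symm
    have := norm_tm t2 z z
    simpa [h1] using this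

/-- `K ⊆ [K Â(X)]` -/
theorem nondeg_right (X : H2 →L[ℂ] H2) (hX : star X * X = 1)
    (M : Submodule ℂ (H →L[ℂ] H)) (hM : IsClosed (M : Set (H →L[ℂ] H)))
    (h : ∀ a ∈ hatA t2 X, ∀ k ∈ cpt H, k * a ∈ M) (T : H →L[ℂ] H) (hT : T ∈ cpt H) : T ∈ M := by
  refine cpt_subset M hM (fun x y => ?_) T hT
  refine cspan_map (InnerProductSpace.rankOne ℂ (E := H) (F := H) x) M hM ?_ y
    (dense_of_orth (S := {z | ∃ a ∈ slicesR t2 t2 X, ∃ w, z = adjoint a w}) ?_ y)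
  · rintro _ ⟨a, ha, w, rfl⟩
    have := h a (subset_cspan _ ha) _ (rankOne_cpt x w)
    convert this using 1
    ext p; simp [adjoint_inner_left]
  · intro z hz
    have h0 : X (t2.tmul z z) = 0 := by
      refine tm_ext t2 fun x' ξ => ?_
      have := hz _ ⟨_, slice_mem t2 X ξ z, x', rfl⟩
      rw [adjoint_inner_left] at this
      simpa [adjoint_inner_right, Lt_apply] using this
    have h1 : t2.tmul z z = 0 := by
      have := congrArg (fun S : H2 →L[ℂ] H2 => S (t2.tmul z z)) hX
      simpa [h0] using this.symm
    have := norm_tm t2 z z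
    simpa [h1] using this

theorem star_flip (Sg : H2 →L[ℂ] H2) (hSg : ∀ a b : H, Sg (t2.tmul a b) = t2.tmul b a) :
    star Sg = Sg := by
  refine op_ext t2 fun x y => tm_ext t2 fun u v => ?_
  rw [star_eq_adjoint, adjoint_inner_right, hSg, hSg, t2.inner_tmul, t2.inner_tmul, mul_comm]

/-- Bilinear induction: `φ k k' ∈ M` for all compacts if so on products. -/
theorem bilin_ind (X Y : H2 →L[ℂ] H2) (hX : X * star X = 1) (hY : star Y * Y = 1)
    (φ : (H →L[ℂ] H) →L[ℂ] (H →L[ℂ] H) →L[ℂ] (H2 →L[ℂ] H2))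
    (M : Submodule ℂ (H2 →L[ℂ] H2)) (hM : IsClosed (M : Set (H2 →L[ℂ] H2)))
    (h : ∀ a ∈ hatA t2 X, ∀ b ∈ hatA t2 Y, ∀ k ∈ cpt H, ∀ k' ∈ cpt H, φ (k * b) (a * k') ∈ M) :
    ∀ k ∈ cpt H, ∀ k' ∈ cpt H, φ k k' ∈ M := by
  intro k hk k' hk'
  refine nondeg_right t2 Y hY (M.comap (φ.flip k' : (H →L[ℂ] H) →ₗ[ℂ] (H2 →L[ℂ] H2)))
    (hM.preimage (φ.flip k').continuous) (fun b hb k hk => ?_) k hk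
  exact nondeg_left t2 X hX (M.comap (φ (k * b) : (H →L[ℂ] H) →ₗ[ℂ] (H2 →L[ℂ] H2)))
    (hM.preimage (φ (k * b)).continuous) (fun a ha k' hk' => h a ha b hb k hk k' hk') k' hk'

/-- `T ↦ A T B` as a continuous linear map -/
def sandw (A B : H2 →L[ℂ] H2) : (H2 →L[ℂ] H2) →L[ℂ] (H2 →L[ℂ] H2) :=
  ContinuousLinearMap.mul ℂ _ A ∘L (ContinuousLinearMap.mul ℂ _).flip B

theorem sandw_apply (A B T : H2 →L[ℂ] H2) : sandw A B T = A * (T * B) := rfl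

theorem main1 (W X : H2 →L[ℂ] H2) (hW : W * star W = 1) (hX : star X * X = 1)
    (hassum : cspan {y : H2 →L[ℂ] H2 | ∃ a ∈ hatA t2 W, ∃ b ∈ hatA t2 X,
        ∃ Tb Ta : H2 →L[ℂ] H2, IsTensorOp t2 t2 1 b Tb ∧ IsTensorOp t2 t2 a 1 Ta ∧
          y = Tb * W * Ta}
      = minTensor t2 (hatA t2 W) (hatA t2 X)) :
    cspan {y : H2 →L[ℂ] H2 | ∃ k k' : H →L[ℂ] H, IsCompactOperator k ∧ IsCompactOperator k' ∧
        ∃ Tk Tk' : H2 →L[ℂ] H2, IsTensorOp t2 t2 1 k Tk ∧ IsTensorOp t2 t2 k' 1 Tk' ∧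
          y = Tk * W * Tk'}
      = {T : H2 →L[ℂ] H2 | IsCompactOperator T} := by
  apply Set.Subset.antisymm
  · refine cspan_subset_of_closed (cpt H2) (isClosed_cpt H2) ?_
    rintro _ ⟨k, k', hk, hk', Tk, Tk', h1, h2, rfl⟩
    rw [isTensorOp_right] at h1
    rw [isTensorOp_left] at h2
    subst h1 h2
    let φ : (H →L[ℂ] H) →L[ℂ] (H →L[ℂ] H) →L[ℂ] (H2 →L[ℂ] H2) :=
      (ContinuousLinearMap.mul ℂ (H2 →L[ℂ] H2)).bilinearComp
        ((ContinuousLinearMap.mul ℂ _).flip W ∘L f2 t2) (f1 t2)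
    refine bilin_ind t2 W X hW hX φ (cpt H2) (isClosed_cpt H2) ?_ k hk k' hk'
    intro a ha b hb k hk k' hk'
    have e : φ (k * b) (a * k') = sandw (f2 t2 k) (f1 t2 k') (f2 t2 b * W * f1 t2 a) := by
      change f2 t2 (k * b) * W * f1 t2 (a * k') = _
      rw [sandw_apply, f2_mul, f1_mul]; simp only [mul_assoc]
    rw [e]
    refine cspan_map (sandw (f2 t2 k) (f1 t2 k')) (cpt H2) (isClosed_cpt H2) ?_ _
      (hassum ▸ subset_cspan _ ⟨a, ha, b, hb, _, _, (isTensorOp_right t2 _ _).2 rfl,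
        (isTensorOp_left t2 _ _).2 rfl, rfl⟩ : _ ∈ minTensor t2 (hatA t2 W) (hatA t2 X))
    rintro _ ⟨a, ha, b, hb, h⟩
    rw [isTensorOp_iff] at h
    subst h
    have e : sandw (f2 t2 k) (f1 t2 k') (f1 t2 a * f2 t2 b) = f1 t2 (a * k') * f2 t2 (k * b) := by
      rw [sandw_apply, mul_assoc (f1 t2 a), f_comm, f1_mul, f2_mul, ← mul_assoc, ← mul_assoc,
        f_comm, ← mul_assoc, mul_assoc (f1 t2 a), f_comm]
      simp only [mul_assoc]
    rw [e]
    exact f_cpt t2 _ _ (IsCompactOperator.clm_comp hk' a) (IsCompactOperator.comp_clm hk b)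
  · intro T hT
    rw [cspan_coe]
    refine cpt2_subset t2 _ (Submodule.isClosed_topologicalClosure _) ?_ T hT
    suffices hh : ∀ k ∈ cpt H, ∀ k' ∈ cpt H, f1 t2 k' * f2 t2 k ∈ _ from
      fun k hk k' hk' => hh k' hk' k hk
    let φ : (H →L[ℂ] H) →L[ℂ] (H →L[ℂ] H) →L[ℂ] (H2 →L[ℂ] H2) :=
      (ContinuousLinearMap.mul ℂ (H2 →L[ℂ] H2)).flip.bilinearComp (f2 t2) (f1 t2)
    refine bilin_ind t2 W X hW hX φ _ (Submodule.isClosed_topologicalClosure _) ?_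
    intro a ha b hb k hk k' hk'
    have e : φ (k * b) (a * k') = sandw (f2 t2 k) (f1 t2 k') (f1 t2 a * f2 t2 b) := by
      change f1 t2 (a * k') * f2 t2 (k * b) = _
      symm
      rw [sandw_apply, mul_assoc (f1 t2 a), f_comm, f1_mul, f2_mul, ← mul_assoc, ← mul_assoc,
        f_comm, ← mul_assoc, mul_assoc (f1 t2 a), f_comm]
      simp only [mul_assoc]
    rw [e]
    have hmem : f1 t2 a * f2 t2 b ∈ minTensor t2 (hatA t2 W) (hatA t2 X) :=
      subset_cspan _ ⟨a, ha, b, hb, (isTensorOp_iff t2 _ _ _).2 rfl⟩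
    rw [← hassum] at hmem
    refine cspan_map (sandw (f2 t2 k) (f1 t2 k')) _
      (Submodule.isClosed_topologicalClosure _) ?_ _ hmem
    rintro _ ⟨a, ha, b, hb, Tb, Ta, h1, h2, rfl⟩
    rw [isTensorOp_right] at h1
    rw [isTensorOp_left] at h2
    subst h1 h2
    refine subset_cspan _ ⟨k * b, a * k', IsCompactOperator.comp_clm hk b,
      IsCompactOperator.clm_comp hk' a, _, _, (isTensorOp_right t2 _ _).2 rfl,
        (isTensorOp_left t2 _ _).2 rfl, ?_⟩
    rw [sandw_apply, f2_mul, f1_mul]; simp only [mul_assoc]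

/-- `T ↦ (id ⊗ ⟨e|) T (|e⟩ ⊗ id)` -/
def Phi (e : H) : (H2 →L[ℂ] H2) →L[ℂ] (H →L[ℂ] H) :=
  ContinuousLinearMap.compL ℂ H H2 H (adjoint (Lt t2 e)) ∘L
    (ContinuousLinearMap.compL ℂ H H2 H2).flip (Rt t2 e)

theorem Phi_apply (e : H) (T : H2 →L[ℂ] H2) :
    Phi t2 e T = adjoint (Lt t2 e) ∘L T ∘L Rt t2 e := rfl

theorem Phi_inner (e : H) (T : H2 →L[ℂ] H2) (x y : H) :
    ⟪x, Phi t2 e T y⟫_ℂ = ⟪t2.tmul x e, T (t2.tmul e y)⟫_ℂ := by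
  simp [Phi_apply, adjoint_inner_right, Lt_apply, Rt_apply]

theorem f2_inner (k : H →L[ℂ] H) (x y : H) (z : H2) :
    ⟪t2.tmul x y, f2 t2 k z⟫_ℂ = ⟪t2.tmul x (adjoint k y), z⟫_ℂ := by
  have : f2 t2 k = adjoint (f2 t2 (adjoint k)) := by
    refine op_ext t2 fun x y => tm_ext t2 fun u v => ?_
    rw [adjoint_inner_right, f2_tmul, f2_tmul, t2.inner_tmul, t2.inner_tmul, adjoint_inner_left]
  rw [this, adjoint_inner_right, f2_tmul]

theorem Phi_gen (W Sg : H2 →L[ℂ] H2) (hSg : ∀ a b : H, Sg (t2.tmul a b) = t2.tmul b a)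
    (e : H) (k k' : H →L[ℂ] H) (ζ ζ' : H) :
    ⟪ζ, Phi t2 e (f2 t2 k * W * f1 t2 k') ζ'⟫_ℂ
      = ⟪t2.tmul (adjoint k e) ζ, (Sg * W) (t2.tmul (k' e) ζ')⟫_ℂ := by
  rw [Phi_inner]
  change ⟪_, f2 t2 k (W (f1 t2 k' (t2.tmul e ζ')))⟫_ℂ = ⟪_, Sg (W (t2.tmul (k' e) ζ'))⟫_ℂ
  rw [f1_tmul, f2_inner]
  conv_rhs => rw [← star_flip t2 Sg hSg, star_eq_adjoint, adjoint_inner_right, hSg]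

theorem main2 (W Sg : H2 →L[ℂ] H2) (hSg : ∀ a b : H, Sg (t2.tmul a b) = t2.tmul b a)
    (h : cspan {y : H2 →L[ℂ] H2 | ∃ k k' : H →L[ℂ] H, IsCompactOperator k ∧ IsCompactOperator k' ∧
        ∃ Tk Tk' : H2 →L[ℂ] H2, IsTensorOp t2 t2 1 k Tk ∧ IsTensorOp t2 t2 k' 1 Tk' ∧
          y = Tk * W * Tk'}
      = {T : H2 →L[ℂ] H2 | IsCompactOperator T}) :
    legA t2 (Sg * W) = {T : H →L[ℂ] H | IsCompactOperator T} := by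
  rcases subsingleton_or_nontrivial H with hH | hH
  · have e1 : ∀ T : H →L[ℂ] H, T = 0 := fun T => by ext x; exact Subsingleton.elim _ _
    ext T
    rw [e1 T]
    exact iff_of_true (Submodule.zero_mem (Submodule.span ℂ _).topologicalClosure)
      (cpt H).zero_mem
  obtain ⟨e, he⟩ := exists_norm_eq H (zero_le_one (α := ℝ))
  have hee : ⟪e, e⟫_ℂ = 1 := by simp [inner_self_eq_norm_sq_to_K, he]
  apply Set.Subset.antisymm
  · refine cspan_subset_of_closed (cpt H) (isClosed_cpt H) ?_
    rintro S ⟨y, u, hS⟩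
    have hmem : f2 t2 (InnerProductSpace.rankOne ℂ e y) * W
        * f1 t2 (InnerProductSpace.rankOne ℂ u e) ∈ {T : H2 →L[ℂ] H2 | IsCompactOperator T} := by
      rw [← h]
      exact subset_cspan _ ⟨_, _, rankOne_cpt e y, rankOne_cpt u e, _, _,
        (isTensorOp_right t2 _ _).2 rfl, (isTensorOp_left t2 _ _).2 rfl, rfl⟩
    have e2 : S = Phi t2 e (f2 t2 (InnerProductSpace.rankOne ℂ e y) * W
        * f1 t2 (InnerProductSpace.rankOne ℂ u e)) := by
      ext ζ'
      refine ext_inner_left ℂ fun ζ => ?_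
      rw [hS, Phi_gen t2 W Sg hSg]
      simp [he]
    rw [e2, Phi_apply]
    exact IsCompactOperator.clm_comp (IsCompactOperator.comp_clm hmem (Rt t2 e))
      (adjoint (Lt t2 e))
  · intro k hk
    have hc := f_cpt t2 _ _ hk (rankOne_cpt e e)
    have hc' : Sg * (f1 t2 (InnerProductSpace.rankOne ℂ e e) * f2 t2 k)
        ∈ {T : H2 →L[ℂ] H2 | IsCompactOperator T} :=
      IsCompactOperator.clm_comp (f_cpt t2 _ _ (rankOne_cpt e e) hk) Sg
    have e2 : k = Phi t2 e (Sg * (f1 t2 (InnerProductSpace.rankOne ℂ e e) * f2 t2 k)) := by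
      ext ζ'
      refine ext_inner_left ℂ fun ζ => ?_
      rw [Phi_inner]
      simp [f1_tmul, f2_tmul, hSg, he, t2.inner_tmul]
    rw [← h] at hc'
    rw [e2]
    refine cspan_map (Phi t2 e) (Submodule.span ℂ (slicesL t2 t2 (Sg * W))).topologicalClosure
      (Submodule.isClosed_topologicalClosure _) ?_ _ hc'
    rintro _ ⟨k, k', hk, hk', Tk, Tk', h1, h2, rfl⟩
    rw [isTensorOp_right] at h1
    rw [isTensorOp_left] at h2
    subst h1 h2
    exact subset_cspan _ ⟨_, _, Phi_gen t2 W Sg hSg e k k'⟩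

end T

/-- If `W` is a regular multiplicative unitary on `H` with
`[(1 ⊗ b)·W·(a ⊗ 1) : a ∈ Â(W), b ∈ Â(Ŵ)] = Â(W) ⊗min Â(Ŵ)` (as holds for
manageable `W`), then `[(1 ⊗ k)·W·(k' ⊗ 1) : k, k' ∈ K(H)] = K(H ⊗ H)` and
`[(ω_{ξ,η} ⊗ id)(ΣW)] = K(H)`, i.e. `W` is bi-regular. -/
theorem statement17
    {H H2 H3 : Type*}
    [NormedAddCommGroup H] [InnerProductSpace ℂ H] [CompleteSpace H]
    [NormedAddCommGroup H2] [InnerProductSpace ℂ H2] [CompleteSpace H2]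
    [NormedAddCommGroup H3] [InnerProductSpace ℂ H3] [CompleteSpace H3]
    -- realizations of the tensor products H ⊗ H and H ⊗ H ⊗ H
    (t2 : TensorPair H H H2) (t3 : TensorTriple H H H H3)
    -- W is a unitary on H ⊗ H
    (W : H2 →L[ℂ] H2) (hWu : star W * W = 1 ∧ W * star W = 1)
    -- the legs W₁₂, W₂₃, W₁₃ of W on H ⊗ H ⊗ H
    (W12 W23 W13 : H3 →L[ℂ] H3)
    (hW12 : IsLeg12 t2 t3 W W12) (hW23 : IsLeg23 t2 t3 W W23)
    (hW13 : IsLeg13 t2 t3 W W13)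
    -- the pentagon equation W₂₃W₁₂ = W₁₂W₁₃W₂₃
    (hpent : W23 * W12 = W12 * W13 * W23)
    -- the tensor flip Σ on H ⊗ H
    (Sg : H2 →L[ℂ] H2) (hSg : ∀ a b : H, Sg (t2.tmul a b) = t2.tmul b a)
    -- regularity: C(W) = K(H)
    (hreg : hatA t2 (Sg * W) = {T : H →L[ℂ] H | IsCompactOperator T})
    -- the assumption [(1 ⊗ b)·W·(a ⊗ 1)] = Â(W) ⊗min Â(Ŵ), where Ŵ = ΣW*Σ
    (hassum : cspan {y : H2 →L[ℂ] H2 | ∃ a ∈ hatA t2 W, ∃ b ∈ hatA t2 (Sg * star W * Sg),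
        ∃ Tb Ta : H2 →L[ℂ] H2, IsTensorOp t2 t2 1 b Tb ∧ IsTensorOp t2 t2 a 1 Ta ∧
          y = Tb * W * Ta}
      = minTensor t2 (hatA t2 W) (hatA t2 (Sg * star W * Sg))) :
    cspan {y : H2 →L[ℂ] H2 | ∃ k k' : H →L[ℂ] H, IsCompactOperator k ∧ IsCompactOperator k' ∧
        ∃ Tk Tk' : H2 →L[ℂ] H2, IsTensorOp t2 t2 1 k Tk ∧ IsTensorOp t2 t2 k' 1 Tk' ∧
          y = Tk * W * Tk'}
      = {T : H2 →L[ℂ] H2 | IsCompactOperator T} ∧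
    legA t2 (Sg * W) = {T : H →L[ℂ] H | IsCompactOperator T} := by
  have hss : Sg * Sg = 1 := op_ext t2 fun x y => by simp [hSg]
  have hst := star_flip t2 Sg hSg
  have h1 := main1 t2 W (Sg * star W * Sg) hWu.2 (by
    rw [star_mul, star_mul, star_star, hst]
    calc Sg * (W * Sg) * (Sg * star W * Sg) = Sg * (W * ((Sg * Sg) * (star W * Sg))) := by
          simp only [mul_assoc]
      _ = Sg * ((W * star W) * Sg) := by rw [hss, one_mul, mul_assoc]
      _ = 1 := by rw [hWu.2, one_mul, hss]) hassum
  exact ⟨h1, main2 t2 W Sg hSg h1⟩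
end
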